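/- For all integers r ≥ 0 and s ≥ 1, Σ_{i=0}^{r} (-1)^{r-i} [C(s-2+i, i) + C(s-1+i, i)] ζ₋({1}^{r-i}, 2s+i) = Σ_{r₁+⋯+r_s = r, r_j ≥ 0} ζ*(r₁+2, …, r_s+2). -/

import Mathlib

open scoped BigOperators

/-- Alternating multiple zeta value ζ₋, encoded with mᵢ = m i + 1. -/
noncomputable def zetaMinus {n : ℕ} (k : Fin (n + 1) → ℕ) : ℝ :=
  ∑' m : Fin (n + 1) → ℕ, if StrictMono m then
    (-1 : ℝ) ^ (m (Fin.last n)) * ∏ i, (1 : ℝ) / ((m i + 1 : ℝ) ^ (k i)) else 0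

/-- Multiple zeta-star value ζ*(k₁,…,kₙ), encoded with mᵢ = m i + 1. -/
noncomputable def zetaStar {n : ℕ} (k : Fin n → ℕ) : ℝ :=
  ∑' m : Fin n → ℕ, if Monotone m then ∏ i, (1 : ℝ) / ((m i + 1 : ℝ) ^ (k i)) else 0

open Finset Filter Topology

/-- Sum of `∏ b (mᵢ)` over the chains `m₁, …, mₙ < N` with `mᵢ < β mᵢ₊₁`. -/
noncomputable def chainSum (b : ℕ → ℝ) (β : ℕ → ℕ) : ℕ → ℕ → ℝ
  | 0, _ => 1
  | n + 1, N => ∑ L ∈ range N, b L * chainSum b β n (β L)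

lemma chainSum_nonneg {b : ℕ → ℝ} (hb : ∀ L, 0 ≤ b L) (β : ℕ → ℕ) (n N : ℕ) :
    0 ≤ chainSum b β n N := by
  induction n generalizing N with
  | zero => simp [chainSum]
  | succ n ih => exact sum_nonneg fun L _ => mul_nonneg (hb L) (ih _)

lemma chainSum_succ_succ (b : ℕ → ℝ) (β : ℕ → ℕ) (n N : ℕ) :
    chainSum b β (n + 1) (N + 1) = chainSum b β (n + 1) N + b N * chainSum b β n (β N) := by
  simp [chainSum, sum_range_succ]

section Chains

variable {b : ℕ → ℝ} {β : ℕ → ℕ} {p : ∀ n : ℕ, (Fin n → ℕ) → Prop} [∀ n, DecidablePred (p n)]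

lemma hasSum_snoc_of_hasSum_chain (hb : ∀ L, 0 ≤ b L)
    (hps : ∀ n (m : Fin n → ℕ) L, p (n + 1) (Fin.snoc m L) ↔ p n m ∧ ∀ i, m i < β L)
    {n : ℕ} {w : ℕ → ℝ} (hw : Summable fun L => |w L| * chainSum b β n (β L))
    (ih : ∀ N, HasSum (fun m : Fin n → ℕ => if p n m ∧ ∀ i, m i < N then ∏ i, b (m i) else 0)
      (chainSum b β n N)) :
    HasSum (fun m : Fin (n + 1) → ℕ => if p (n + 1) m then
      w (m (Fin.last n)) * ∏ i : Fin n, b (m i.castSucc) else 0)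
      (∑' L, w L * chainSum b β n (β L)) := by
  rw [← (Fin.snocEquiv fun _ : Fin (n + 1) => ℕ).hasSum_iff]
  have key : ∀ v : ℕ → ℝ, ∀ L, HasSum (fun m : Fin n → ℕ =>
      if p n m ∧ ∀ i, m i < β L then v L * ∏ i, b (m i) else 0)
      (v L * chainSum b β n (β L)) := fun v L => by
    simpa [mul_ite] using (ih (β L)).mul_left (v L)
  have hs : Summable fun x : ℕ × (Fin n → ℕ) =>
      if p n x.2 ∧ ∀ i, x.2 i < β x.1 then w x.1 * ∏ i, b (x.2 i) else 0 := by
    refine Summable.of_norm ?_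
    have heq : (fun x : ℕ × (Fin n → ℕ) =>
        ‖if p n x.2 ∧ ∀ i, x.2 i < β x.1 then w x.1 * ∏ i, b (x.2 i) else 0‖) =
        fun x => if p n x.2 ∧ ∀ i, x.2 i < β x.1 then |w x.1| * ∏ i, b (x.2 i) else 0 := by
      funext x
      split_ifs
      · rw [norm_mul, Real.norm_eq_abs, Real.norm_of_nonneg (prod_nonneg fun i _ => hb _)]
      · simp
    rw [heq, summable_prod_of_nonneg]
    · refine ⟨fun L => (key (fun L => |w L|) L).summable, ?_⟩
      simpa only [(key (fun L => |w L|) _).tsum_eq] using hw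
    · intro x
      dsimp only [Pi.zero_apply]
      split_ifs
      · exact mul_nonneg (abs_nonneg _) (prod_nonneg fun i _ => hb _)
      · exact le_rfl
  have h := hs.hasSum.prod_fiberwise (key w)
  rw [h.tsum_eq]
  convert hs.hasSum using 1
  funext x
  simp only [Function.comp_apply, Fin.snocEquiv, Equiv.coe_fn_mk, Fin.snoc_last,
    Fin.snoc_castSucc, hps]

lemma hasSum_chain (hb : ∀ L, 0 ≤ b L) (hβ : ∀ L, β L ≤ L + 1) (hp0 : ∀ m, p 0 m)
    (hps : ∀ n (m : Fin n → ℕ) L, p (n + 1) (Fin.snoc m L) ↔ p n m ∧ ∀ i, m i < β L)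
    (n N : ℕ) :
    HasSum (fun m : Fin n → ℕ => if p n m ∧ ∀ i, m i < N then ∏ i, b (m i) else 0)
      (chainSum b β n N) := by
  induction n generalizing N with
  | zero =>
    simp only [hp0, IsEmpty.forall_iff, and_self, if_true, univ_eq_empty, prod_empty, chainSum]
    exact hasSum_unique _
  | succ n ih =>
    have hz : ∀ L ∉ range N, (if L < N then b L else 0) = 0 := fun L hL => by
      simpa using fun h => absurd (mem_range.2 h) hL
    have h := hasSum_snoc_of_hasSum_chain (w := fun L => if L < N then b L else 0) hb hps
      (summable_of_ne_finset_zero (s := range N) fun L hL => by simp [hz L hL]) ih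
    rw [tsum_eq_sum (s := range N) fun L hL => by simp [hz L hL]] at h
    have hc : ∑ L ∈ range N, (if L < N then b L else 0) * chainSum b β n (β L) =
        chainSum b β (n + 1) N :=
      sum_congr rfl fun L hL => by rw [if_pos (mem_range.1 hL)]
    rw [hc] at h
    convert h using 1
    funext m
    obtain ⟨⟨L, m⟩, rfl⟩ := (Fin.snocEquiv fun _ : Fin (n + 1) => ℕ).surjective m
    have hlt : p (n + 1) (Fin.snoc m L) →
        ((∀ i, (Fin.snoc m L : Fin (n + 1) → ℕ) i < N) ↔ L < N) := fun hm => by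
      refine ⟨fun h => by simpa using h (Fin.last n), fun h i => ?_⟩
      refine Fin.lastCases (by simpa using h) (fun i => ?_) i
      have h₁ := ((hps n m L).1 hm).2 i
      have h₂ := hβ L
      rw [Fin.snoc_castSucc]
      omega
    simp only [Fin.snocEquiv, Equiv.coe_fn_mk, Fin.snoc_last, Fin.prod_univ_castSucc,
      Fin.snoc_castSucc]
    by_cases hm : p (n + 1) (Fin.snoc m L)
    · by_cases hL : L < N <;> simp [hm, hlt hm, hL, mul_comm]
    · simp [hm]

end Chains

lemma strictMono_snoc_iff {n : ℕ} (m : Fin n → ℕ) (L : ℕ) :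
    StrictMono (Fin.snoc m L : Fin (n + 1) → ℕ) ↔ StrictMono m ∧ ∀ i, m i < L := by
  constructor
  · intro h
    refine ⟨fun i j hij => ?_, fun i => ?_⟩
    · simpa using h (Fin.castSucc_lt_castSucc_iff.2 hij)
    · simpa using h (Fin.castSucc_lt_last i)
  · rintro ⟨h, hL⟩ i j
    refine Fin.lastCases ?_ (fun j => ?_) j <;> refine Fin.lastCases ?_ (fun i => ?_) i
    · simp
    · intro _
      simpa using hL i
    · intro hij
      exact absurd hij (not_lt.2 (Fin.le_last _))
    · simpa using fun hij => h hij

lemma monotone_snoc_iff {n : ℕ} (m : Fin n → ℕ) (L : ℕ) :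
    Monotone (Fin.snoc m L : Fin (n + 1) → ℕ) ↔ Monotone m ∧ ∀ i, m i < L + 1 := by
  constructor
  · intro h
    refine ⟨fun i j hij => ?_, fun i => ?_⟩
    · simpa using h (Fin.castSucc_le_castSucc_iff.2 hij)
    · simpa [Nat.lt_succ_iff] using h (Fin.castSucc_lt_last i).le
  · rintro ⟨h, hL⟩ i j
    refine Fin.lastCases ?_ (fun j => ?_) j <;> refine Fin.lastCases ?_ (fun i => ?_) i
    · simp
    · simpa using fun _ => Nat.lt_succ_iff.1 (hL i)
    · intro hij
      exact absurd hij (not_le.2 (Fin.castSucc_lt_last _))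
    · simpa using fun hij => h hij

/-- The finite sum `∑ ∏ 1 / (mᵢ + 1)` over `m₁ < ⋯ < mₙ < N`. -/
noncomputable abbrev harmonicChain (n N : ℕ) : ℝ := chainSum (fun L => 1 / ((L : ℝ) + 1)) id n N

lemma harmonicChain_nonneg (n N : ℕ) : 0 ≤ harmonicChain n N :=
  chainSum_nonneg (fun _ => by positivity) _ _ _

lemma zetaMinus_eq_tsum {n k : ℕ}
    (h : Summable fun L : ℕ => 1 / ((L : ℝ) + 1) ^ k * harmonicChain n L) :
    zetaMinus (fun j : Fin (n + 1) => if j = Fin.last n then k else 1) =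
      ∑' L : ℕ, (-1) ^ L / ((L : ℝ) + 1) ^ k * harmonicChain n L := by
  have hb : ∀ L : ℕ, 0 ≤ 1 / ((L : ℝ) + 1) := fun L => by positivity
  have hps := fun n (m : Fin n → ℕ) L => strictMono_snoc_iff m L
  have hw : Summable fun L : ℕ => |(-1 : ℝ) ^ L / ((L : ℝ) + 1) ^ k| * harmonicChain n L := by
    convert h using 3 with L
    rw [abs_div, abs_pow, abs_neg, abs_one, one_pow, abs_of_nonneg (by positivity)]
  have hchain : ∀ N, HasSum (fun m : Fin n → ℕ => if StrictMono m ∧ ∀ i, m i < N then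
      ∏ i, 1 / ((m i : ℝ) + 1) else 0) (harmonicChain n N) :=
    hasSum_chain (p := fun n (m : Fin n → ℕ) => StrictMono m) (β := id)
      (b := fun L : ℕ => 1 / ((L : ℝ) + 1)) hb (fun L => Nat.le_succ L)
      (fun m i => i.elim0) hps n
  have hh := hasSum_snoc_of_hasSum_chain (β := id) (p := fun n (m : Fin n → ℕ) => StrictMono m)
    (b := fun L : ℕ => 1 / ((L : ℝ) + 1))
    (n := n) (w := fun L : ℕ => (-1 : ℝ) ^ L / ((L : ℝ) + 1) ^ k) hb hps hw hchain
  rw [zetaMinus]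
  refine Eq.trans (tsum_congr fun m => ?_) hh.tsum_eq
  simp only [Fin.prod_univ_castSucc, if_true, (Fin.castSucc_lt_last _).ne, if_false, pow_one]
  split_ifs <;> ring

lemma hasSum_harmonicChain (t : ℝ) (N : ℕ) :
    HasSum (fun j => t ^ j * harmonicChain j N) (∏ l ∈ range N, (1 + t / ((l : ℝ) + 1))) := by
  induction N with
  | zero =>
    convert hasSum_single (f := fun j => t ^ j * harmonicChain j 0) 0 ?_ using 1
    · simp [chainSum]
    · intro j hj
      obtain ⟨j, rfl⟩ := Nat.exists_eq_succ_of_ne_zero hj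
      simp [chainSum]
  | succ N ih =>
    have h₁ := (hasSum_nat_add_iff' 1).2 ih
    have h₂ := h₁.add (ih.mul_left (t / ((N : ℝ) + 1)))
    have hrec : (fun j => t ^ (j + 1) * harmonicChain (j + 1) N +
        t / ((N : ℝ) + 1) * (t ^ j * harmonicChain j N)) =
        fun j => t ^ (j + 1) * harmonicChain (j + 1) (N + 1) := by
      funext j
      rw [show harmonicChain (j + 1) (N + 1) = _ from chainSum_succ_succ _ _ _ _, id]
      ring
    rw [hrec] at h₂
    have h₃ := HasSum.zero_add (f := fun j => t ^ j * harmonicChain j (N + 1)) h₂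
    convert h₃ using 1
    simp [prod_range_succ, chainSum]
    ring

lemma summable_prod_one_add_div {t : ℝ} (h0 : 0 ≤ t) (h1 : t < 1) :
    Summable fun M : ℕ => (∏ l ∈ range M, (1 + t / ((l : ℝ) + 1))) / ((M : ℝ) + 1) ^ 2 := by
  set Q : ℕ → ℝ := fun M => ∏ l ∈ range M, (1 + t / ((l : ℝ) + 1)) with hQ
  have hQ0 : ∀ M, 0 ≤ Q M := fun M => prod_nonneg fun l _ => by positivity
  have hQs : ∀ M, Q (M + 1) = Q M * (1 + t / ((M : ℝ) + 1)) := fun M => prod_range_succ _ _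
  have h1' : 0 < 1 - t := by linarith
  have hsum : ∀ n, ∑ M ∈ range n, (1 - t) * (Q M / (((M : ℝ) + 1) * (M + 2))) =
      1 - Q n / ((n : ℝ) + 1) := fun n => by
    induction n with
    | zero => simp [hQ]
    | succ n ih =>
      rw [sum_range_succ, ih, hQs]
      push_cast
      field_simp
      ring
  have hs : Summable fun M : ℕ => Q M / (((M : ℝ) + 1) * (M + 2)) := by
    refine (summable_mul_left_iff h1'.ne').1 (summable_of_sum_range_le (c := 1) (fun M => ?_)
      fun n => ?_)
    · exact mul_nonneg h1'.le (div_nonneg (hQ0 M) (by positivity))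
    · rw [hsum]
      have := div_nonneg (hQ0 n) (by positivity : 0 ≤ (n : ℝ) + 1)
      linarith
  refine Summable.of_nonneg_of_le (fun M => div_nonneg (hQ0 M) (by positivity)) (fun M => ?_)
    (hs.mul_left 2)
  rw [← mul_div_assoc, div_le_div_iff₀ (by positivity) (by positivity)]
  have : ((M : ℝ) + 1) * (M + 2) ≤ 2 * (M + 1) ^ 2 := by
    nlinarith [(Nat.cast_nonneg M : (0 : ℝ) ≤ M)]
  nlinarith [mul_le_mul_of_nonneg_left this (hQ0 M)]

lemma summable_harmonicChain (j : ℕ) {k : ℕ} (hk : 2 ≤ k) :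
    Summable fun L : ℕ => 1 / ((L : ℝ) + 1) ^ k * harmonicChain j L := by
  refine Summable.of_nonneg_of_le
    (fun L => mul_nonneg (by positivity) (harmonicChain_nonneg j L)) (fun L => ?_)
    ((summable_prod_one_add_div (t := 1 / 2) (by norm_num) (by norm_num)).mul_left (2 ^ j))
  have h := le_hasSum (hasSum_harmonicChain (1 / 2) L) j fun i _ =>
    mul_nonneg (by positivity) (harmonicChain_nonneg i L)
  have h' : harmonicChain j L ≤ 2 ^ j * ∏ l ∈ range L, (1 + 1 / 2 / ((l : ℝ) + 1)) := by
    calc harmonicChain j L = 2 ^ j * ((1 / 2) ^ j * harmonicChain j L) := by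
          rw [← mul_assoc, ← mul_pow]; norm_num
      _ ≤ _ := mul_le_mul_of_nonneg_left h (by positivity)
  have hp : 1 / ((L : ℝ) + 1) ^ k ≤ 1 / ((L : ℝ) + 1) ^ 2 :=
    one_div_le_one_div_of_le (by positivity)
      (pow_le_pow_right₀ (by linarith [(Nat.cast_nonneg L : (0 : ℝ) ≤ L)]) hk)
  calc _ ≤ 1 / ((L : ℝ) + 1) ^ 2 * _ :=
        mul_le_mul hp h' (harmonicChain_nonneg j L) (by positivity)
    _ = _ := by ring

/-- The value at `x` of the generating series of `1 / (L + 1) ^ (c + 2)` over `c`. -/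
noncomputable def starWeight (x : ℝ) (L : ℕ) : ℝ := 1 / (((L : ℝ) + 1) * (L + 1 - x))

/-- The coefficient of `starWeight x M ^ s` in the partial fraction expansion of the complete
homogeneous symmetric functions in all the `starWeight x L`. -/
noncomputable def minusWeight (x : ℝ) (M : ℕ) : ℝ :=
  (-1) ^ M * (∏ l ∈ range M, (1 - x / ((l : ℝ) + 1))) * (2 - x / ((M : ℝ) + 1))

/-- The factor relating `minusWeight` to the same expansion in finitely many variables. -/
noncomputable def connector (x : ℝ) (N M : ℕ) : ℝ :=
  ∏ j ∈ range (M + 1), ((N : ℝ) - j) / (N + j + 1 - x)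

lemma connector_eq_zero (x : ℝ) {N M : ℕ} (h : N ≤ M) : connector x N M = 0 :=
  prod_eq_zero (mem_range.2 (Nat.lt_succ_of_le h)) (by simp)

lemma natCast_add_one_sub_pos {x : ℝ} (hx : x < 1) (L : ℕ) : 0 < (L : ℝ) + 1 - x := by
  linarith [(Nat.cast_nonneg L : (0 : ℝ) ≤ L)]

lemma starWeight_pos {x : ℝ} (hx : x < 1) (L : ℕ) : 0 < starWeight x L := by
  have := natCast_add_one_sub_pos hx L
  rw [starWeight]
  positivity

lemma abs_connector_le_one {x : ℝ} (hx : x < 1) (N M : ℕ) : |connector x N M| ≤ 1 := by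
  rcases le_or_gt N M with h | h
  · simp [connector_eq_zero x h]
  · rw [connector, abs_prod]
    refine prod_le_one (fun _ _ => abs_nonneg _) fun j hj => ?_
    have hjN : (j : ℝ) ≤ N := by exact_mod_cast (by have := mem_range.1 hj; omega : j ≤ N)
    have hj0 : (0 : ℝ) ≤ j := Nat.cast_nonneg j
    rw [abs_of_nonneg (div_nonneg (by linarith) (by linarith)), div_le_one (by linarith)]
    linarith

lemma tendsto_connector (x : ℝ) (M : ℕ) :
    Tendsto (fun N => connector x N M) atTop (𝓝 1) := by
  have h : ∀ j : ℕ, Tendsto (fun N : ℕ => ((N : ℝ) - j) / (N + j + 1 - x)) atTop (𝓝 1) := by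
    intro j
    have h₁ : Tendsto (fun N : ℕ => (N : ℝ) + (j + 1 - x)) atTop atTop :=
      tendsto_atTop_add_const_right _ _ tendsto_natCast_atTop_atTop
    have h₂ : Tendsto (fun N : ℕ => 1 - (2 * j + 1 - x) / ((N : ℝ) + (j + 1 - x))) atTop
        (𝓝 (1 - 0)) := tendsto_const_nhds.sub (tendsto_const_nhds.div_atTop h₁)
    rw [sub_zero] at h₂
    refine h₂.congr' ?_
    filter_upwards [h₁.eventually_gt_atTop 0] with N hN
    rw [show (N : ℝ) + j + 1 - x = N + (j + 1 - x) by ring]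
    field_simp
    ring
  simpa [connector] using tendsto_finsetProd (range (M + 1)) fun j _ => h j

lemma mul_connector {x : ℝ} (hx : x < 1) (N M : ℕ) :
    ((N : ℝ) + 1) * (N + 1 - x) * connector x N M =
      (N - M) * (N + M + 2 - x) * connector x (N + 1) M := by
  have hN : (0 : ℝ) ≤ N := Nat.cast_nonneg N
  induction M with
  | zero =>
    have h₁ : (N : ℝ) + 1 - x ≠ 0 := by linarith
    have h₂ : (N : ℝ) + 1 + 1 - x ≠ 0 := by linarith
    simp [connector]
    field_simp
    ring
  | succ M ih =>
    have hM : (0 : ℝ) ≤ M := Nat.cast_nonneg M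
    have hs : ∀ K, connector x K (M + 1) =
        connector x K M * (((K : ℝ) - (M + 1)) / (K + (M + 1) + 1 - x)) := fun K => by
      rw [connector, prod_range_succ, connector]
      push_cast
      rfl
    have h₁ : (N : ℝ) + (M + 1) + 1 - x ≠ 0 := by linarith
    have h₂ : (N : ℝ) + 1 + (M + 1) + 1 - x ≠ 0 := by linarith
    rw [hs, hs, ← mul_assoc, ih]
    push_cast
    field_simp
    ring

lemma connector_succ_sub {x : ℝ} (hx : x < 1) (N M : ℕ) :
    starWeight x M * (connector x (N + 1) M - connector x N M) =
      starWeight x N * connector x (N + 1) M := by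
  have h := mul_connector hx N M
  have h₁ := natCast_add_one_sub_pos hx N
  have h₂ := natCast_add_one_sub_pos hx M
  rw [starWeight, starWeight]
  field_simp
  linear_combination -h

lemma sum_minusWeight_mul_connector {x : ℝ} (hx : x < 1) (N : ℕ) :
    ∑ M ∈ range (N + 1), minusWeight x M * connector x (N + 1) M = 1 := by
  have hN : (0 : ℝ) ≤ N := Nat.cast_nonneg N
  have hpart : ∀ K, ∑ M ∈ range K, minusWeight x M * connector x (N + 1) M =
      1 - (-1) ^ K * (∏ l ∈ range K, (1 - x / ((l : ℝ) + 1))) *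
        ∏ j ∈ range K, ((N : ℝ) - j) / (N + j + 2 - x) := by
    intro K
    induction K with
    | zero => simp
    | succ K ih =>
      have hK : (0 : ℝ) ≤ K := Nat.cast_nonneg K
      have hc : connector x (N + 1) K = (∏ j ∈ range K, ((N : ℝ) - j) / (N + j + 2 - x)) *
          ((N + 1) / (N + K + 2 - x)) := by
        clear ih
        induction K with
        | zero => simp [connector]; ring
        | succ K ih =>
          have hK' : (0 : ℝ) ≤ K := Nat.cast_nonneg K
          have h₁ : (N : ℝ) + K + 2 - x ≠ 0 := by linarith
          rw [connector, prod_range_succ, ← connector, ih hK', prod_range_succ]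
          push_cast
          rw [show (N : ℝ) + 1 + (K + 1) + 1 - x = N + (K + 1) + 2 - x by ring,
            show (N : ℝ) + 1 - (K + 1) = N - K by ring]
          field_simp
      have h₁ : (N : ℝ) + K + 2 - x ≠ 0 := by linarith
      rw [sum_range_succ, ih, hc, minusWeight, prod_range_succ, prod_range_succ, pow_succ]
      field_simp
      ring
  rw [hpart, prod_eq_zero (i := N) (s := range (N + 1)) (f := fun j : ℕ =>
    ((N : ℝ) - j) / (N + j + 2 - x)) (by simp) (by simp), mul_zero, sub_zero]

lemma sum_range_connector (x : ℝ) (f : ℕ → ℝ) (N : ℕ) :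
    ∑ M ∈ range (N + 1), f M * connector x N M = ∑ M ∈ range N, f M * connector x N M := by
  rw [sum_range_succ, connector_eq_zero x le_rfl, mul_zero, add_zero]

lemma chainSum_starWeight {x : ℝ} (hx : x < 1) (s N : ℕ) :
    chainSum (starWeight x) Nat.succ (s + 1) N =
      ∑ M ∈ range N, minusWeight x M * starWeight x M ^ (s + 1) * connector x N M := by
  induction s generalizing N with
  | zero =>
    induction N with
    | zero => simp [chainSum]
    | succ N ih =>
      rw [chainSum_succ_succ, ih, ← sum_range_connector, chainSum, mul_one,
        ← mul_one (starWeight x N), ← sum_minusWeight_mul_connector hx N, mul_sum,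
        ← sum_add_distrib]
      refine sum_congr rfl fun M _ => ?_
      linear_combination -minusWeight x M * connector_succ_sub hx N M
  | succ s ihs =>
    induction N with
    | zero => simp [chainSum]
    | succ N ih =>
      rw [chainSum_succ_succ, ih, ← sum_range_connector, ihs, mul_sum, ← sum_add_distrib]
      refine sum_congr rfl fun M _ => ?_
      linear_combination (-minusWeight x M * starWeight x M ^ (s + 1)) * connector_succ_sub hx N M

lemma tendsto_chainSum_starWeight {x : ℝ} (hx : x < 1) (s : ℕ)
    (hs : Summable fun M => minusWeight x M * starWeight x M ^ (s + 1)) :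
    Tendsto (chainSum (starWeight x) Nat.succ (s + 1)) atTop
      (𝓝 (∑' M, minusWeight x M * starWeight x M ^ (s + 1))) := by
  have hlim : ∀ M, Tendsto
      (fun N => minusWeight x M * starWeight x M ^ (s + 1) * connector x N M) atTop
      (𝓝 (minusWeight x M * starWeight x M ^ (s + 1))) := fun M => by
    simpa using (tendsto_connector x M).const_mul (minusWeight x M * starWeight x M ^ (s + 1))
  have h := tendsto_tsum_of_dominated_convergence hs.abs hlim
    (Eventually.of_forall fun N M => by
      rw [Real.norm_eq_abs, abs_mul]
      exact mul_le_of_le_one_right (abs_nonneg _) (abs_connector_le_one hx N M))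
  refine h.congr fun N => ?_
  rw [chainSum_starWeight hx, tsum_eq_sum]
  intro M hM
  rw [connector_eq_zero x (by simpa using hM), mul_zero]

lemma hasSum_prod_pi_of_summable_abs {α : Type*} {n : ℕ} (f : Fin n → α → ℝ)
    (hf : ∀ j, Summable fun a => |f j a|) :
    (Summable fun v : Fin n → α => |∏ j, f j (v j)|) ∧
      HasSum (fun v : Fin n → α => ∏ j, f j (v j)) (∏ j, ∑' a, f j a) := by
  induction n with
  | zero =>
    simp only [univ_eq_empty, prod_empty]
    exact ⟨(hasSum_unique _).summable, hasSum_unique _⟩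
  | succ n ih =>
    obtain ⟨ih₁, ih₂⟩ := ih (fun j => f j.succ) fun j => hf j.succ
    have hs : Summable fun x : α × (Fin n → α) => |f 0 x.1 * ∏ j, f j.succ (x.2 j)| := by
      simpa only [abs_mul] using (hf 0).mul_of_nonneg ih₁ (fun _ => abs_nonneg _)
        fun _ => abs_nonneg _
    constructor
    · rw [← (Fin.consEquiv fun _ : Fin (n + 1) => α).summable_iff]
      simpa [Function.comp_def, Fin.prod_univ_succ, Fin.consEquiv] using hs
    · rw [← (Fin.consEquiv fun _ : Fin (n + 1) => α).hasSum_iff, Fin.prod_univ_succ]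
      simpa [Function.comp_def, Fin.prod_univ_succ, Fin.consEquiv] using
        (hf 0).of_abs.hasSum.mul ih₂ hs.of_abs

lemma summable_abs_pow_div {x : ℝ} (hx : |x| < 1) :
    Summable fun a : ℕ × ℕ => |x ^ a.2 / ((a.1 : ℝ) + 1) ^ (a.2 + 2)| := by
  have h₁ : Summable fun m : ℕ => 1 / ((m : ℝ) + 1) ^ 2 := by
    have := (summable_nat_add_iff 1).2 (Real.summable_one_div_nat_pow.2 one_lt_two)
    simpa using this
  refine Summable.of_nonneg_of_le (fun _ => abs_nonneg _) (fun a => ?_)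
    (h₁.mul_of_nonneg (summable_geometric_of_lt_one (abs_nonneg x) hx)
      (fun _ => by dsimp; positivity) fun _ => by dsimp; positivity)
  have h1 : (1 : ℝ) ≤ (a.1 : ℝ) + 1 := by linarith [(Nat.cast_nonneg a.1 : (0 : ℝ) ≤ a.1)]
  rw [abs_div, abs_pow, abs_of_pos (by positivity : 0 < ((a.1 : ℝ) + 1) ^ (a.2 + 2)),
    div_eq_mul_one_div, mul_comm]
  exact mul_le_mul_of_nonneg_right (one_div_le_one_div_of_le (by positivity)
    (pow_le_pow_right₀ h1 (by omega))) (by positivity)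

lemma tsum_pow_div_eq_starWeight {x : ℝ} (hx : |x| < 1) (L : ℕ) :
    ∑' c : ℕ, x ^ c / ((L : ℝ) + 1) ^ (c + 2) = starWeight x L := by
  have hL : (0 : ℝ) ≤ L := Nat.cast_nonneg L
  have hlt : |x / ((L : ℝ) + 1)| < 1 := by
    rw [abs_div, abs_of_pos (by positivity : 0 < (L : ℝ) + 1), div_lt_one (by positivity)]
    linarith
  have h := ((hasSum_geometric_of_abs_lt_one hlt).mul_left (1 / ((L : ℝ) + 1) ^ 2)).tsum_eq
  have h₁ := natCast_add_one_sub_pos (abs_lt.1 hx).2 L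
  have h₂ : 1 - x / ((L : ℝ) + 1) = (L + 1 - x) / (L + 1) := by field_simp
  rw [h₂] at h
  refine Eq.trans (tsum_congr fun c => ?_) (h.trans ?_)
  · rw [div_pow, pow_add]
    field_simp
  · rw [starWeight]
    field_simp

lemma hasSum_zetaStar {x : ℝ} (hx : |x| < 1) (s : ℕ) :
    (Summable fun m : Fin s → ℕ => if Monotone m then ∏ j, starWeight x (m j) else 0) ∧
    HasSum (fun r => x ^ r * ∑ c ∈ Nat.antidiagonalTuple s r, zetaStar fun j => c j + 2)
      (∑' m : Fin s → ℕ, if Monotone m then ∏ j, starWeight x (m j) else 0) := by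
  set u : (Fin s → ℕ) × (Fin s → ℕ) → ℝ := fun v =>
    if Monotone v.1 then ∏ j, x ^ v.2 j / ((v.1 j : ℝ) + 1) ^ (v.2 j + 2) else 0 with hu
  have hsum : Summable u := by
    have h := (hasSum_prod_pi_of_summable_abs (n := s) (fun _ => _)
      fun _ => summable_abs_pow_div hx).1
    rw [← (Equiv.arrowProdEquivProdArrow (Fin s) (fun _ => ℕ) fun _ => ℕ).summable_iff]
    refine Summable.of_norm_bounded h fun v => ?_
    simp only [hu, Function.comp_apply, Equiv.arrowProdEquivProdArrow, Equiv.coe_fn_mk]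
    split_ifs
    · exact le_rfl
    · simp
  have hc : ∀ m : Fin s → ℕ, HasSum (fun c => u (m, c))
      (if Monotone m then ∏ j, starWeight x (m j) else 0) := by
    intro m
    by_cases hm : Monotone m
    · simp only [hu, hm, if_true]
      have h := (hasSum_prod_pi_of_summable_abs
        (fun (j : Fin s) (c : ℕ) => x ^ c / ((m j : ℝ) + 1) ^ (c + 2))
        fun j => (summable_abs_pow_div hx).comp_injective
          (i := fun c => (m j, c)) (fun _ _ h => (Prod.mk.inj h).2)).2
      simpa only [tsum_pow_div_eq_starWeight hx] using h
    · simp only [hu, hm, if_false]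
      exact hasSum_zero
  have hm : ∀ c : Fin s → ℕ, HasSum (fun m => u (m, c))
      (x ^ (∑ j, c j) * zetaStar fun j => c j + 2) := by
    intro c
    have hfac : ∀ m, u (m, c) = x ^ (∑ j, c j) *
        (if Monotone m then ∏ j, (1 : ℝ) / ((m j + 1 : ℝ) ^ (c j + 2)) else 0) := fun m => by
      simp only [hu, mul_ite, mul_zero]
      refine if_congr Iff.rfl ?_ rfl
      rw [← prod_pow_eq_pow_sum, ← prod_mul_distrib]
      exact prod_congr rfl fun j _ => by ring
    have hs : Summable fun m => u (m, c) :=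
      hsum.comp_injective (i := fun m => (m, c)) fun _ _ h => (Prod.mk.inj h).1
    have h := hs.hasSum
    rwa [tsum_congr hfac, tsum_mul_left] at h
  have hfib := hsum.hasSum.prod_fiberwise hc
  refine ⟨hfib.summable, ?_⟩
  rw [hfib.tsum_eq]
  have hswap := ((Equiv.prodComm _ _).hasSum_iff.2 hsum.hasSum).prod_fiberwise hm
  have hsig := (Nat.sigmaAntidiagonalTupleEquivTuple s).hasSum_iff.2 hswap
  refine hsig.sigma fun r => ?_
  have hfin := hasSum_fintype fun c : Nat.antidiagonalTuple s r =>
    x ^ r * zetaStar fun j => (c : Fin s → ℕ) j + 2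
  rw [← mul_sum, sum_coe_sort (Nat.antidiagonalTuple s r)
    fun c => zetaStar fun j => c j + 2] at hfin
  convert hfin using 2 with c
  simp only [Function.comp_apply, Nat.sigmaAntidiagonalTupleEquivTuple, Equiv.coe_fn_mk]
  rw [Nat.mem_antidiagonalTuple.1 c.2]

lemma tendsto_chainSum_starWeight_tsum {x : ℝ} (hx : |x| < 1) (s : ℕ) :
    Tendsto (chainSum (starWeight x) Nat.succ s) atTop
      (𝓝 (∑' m : Fin s → ℕ, if Monotone m then ∏ j, starWeight x (m j) else 0)) := by
  have hpos := fun L => (starWeight_pos (abs_lt.1 hx).2 L).le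
  have hchain : ∀ N, HasSum (fun m : Fin s → ℕ => if Monotone m ∧ ∀ i, m i < N then
      ∏ i, starWeight x (m i) else 0) (chainSum (starWeight x) Nat.succ s N) :=
    hasSum_chain (p := fun n (m : Fin n → ℕ) => Monotone m) (β := Nat.succ)
      (b := starWeight x) hpos (fun L => le_rfl) (fun m i => i.elim0)
      (fun n m L => monotone_snoc_iff m L) s
  have hlim : ∀ m : Fin s → ℕ, Tendsto (fun N => if Monotone m ∧ ∀ i, m i < N then
      ∏ i, starWeight x (m i) else 0) atTop
      (𝓝 (if Monotone m then ∏ j, starWeight x (m j) else 0)) := fun m => by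
    refine tendsto_const_nhds.congr' ?_
    filter_upwards [eventually_all.2 fun i => eventually_gt_atTop (m i)] with N hN
    simp [hN]
  have h := tendsto_tsum_of_dominated_convergence (hasSum_zetaStar hx s).1 hlim
    (Eventually.of_forall fun N m => by
      have hp : 0 ≤ ∏ i, starWeight x (m i) := prod_nonneg fun i _ => hpos _
      by_cases hm : Monotone m
      · by_cases hN : ∀ i, m i < N
        · simp [hm, hN, abs_of_nonneg (hpos _)]
        · simpa [hm, hN] using hp
      · simp [hm])
  exact h.congr fun N => (hchain N).tsum_eq

lemma hasSum_choose_add_choose {y : ℝ} (hy : |y| < 1) (k : ℕ) :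
    HasSum (fun i => (((k + 1 + i - 2).choose i + (k + 1 + i - 1).choose i : ℕ) : ℝ) * y ^ i)
      ((2 - y) / (1 - y) ^ (k + 1)) := by
  have hy1 : 1 - y ≠ 0 := by linarith [(abs_lt.1 hy).2]
  have h₂ : ∀ k, HasSum (fun i => ((k + i).choose i : ℝ) * y ^ i) (1 / (1 - y) ^ (k + 1)) :=
    fun k => by
      refine (congrArg (HasSum · _) (funext fun i => ?_)).mpr
        (hasSum_choose_mul_geometric_of_norm_lt_one k (r := y) hy)
      rw [add_comm, Nat.choose_symm_add]
  have h₁ : HasSum (fun i => ((k + 1 + i - 2).choose i : ℝ) * y ^ i) (1 / (1 - y) ^ k) := by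
    cases k with
    | zero =>
      convert hasSum_single (f := fun i => ((0 + 1 + i - 2).choose i : ℝ) * y ^ i) 0 ?_ using 1
      · simp
      · intro i hi
        rw [Nat.choose_eq_zero_of_lt (by omega)]
        simp
    | succ k =>
      convert h₂ k using 5 with i
      omega
  convert h₁.add (h₂ k) using 1
  · funext i
    rw [show k + 1 + i - 1 = k + i by omega]
    push_cast
    ring
  · field_simp
    ring

/-- The terms of the expansion of `minusWeight x M * starWeight x M ^ (k + 1)` in powers of `x`. -/
noncomputable def minusTerm (k : ℕ) (x : ℝ) (v : ℕ × ℕ × ℕ) : ℝ :=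
  (-1) ^ v.1 / ((v.1 : ℝ) + 1) ^ (2 * (k + 1)) *
    ((((k + 1 + v.2.1 - 2).choose v.2.1 + (k + 1 + v.2.1 - 1).choose v.2.1 : ℕ) : ℝ) *
      (x / ((v.1 : ℝ) + 1)) ^ v.2.1 * ((-x) ^ v.2.2 * harmonicChain v.2.2 v.1))

lemma abs_div_natCast_add_one_le (x : ℝ) (M : ℕ) : |x / ((M : ℝ) + 1)| ≤ |x| := by
  have hM : (0 : ℝ) ≤ M := Nat.cast_nonneg M
  rw [abs_div, abs_of_pos (by positivity : 0 < (M : ℝ) + 1)]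
  exact div_le_self (abs_nonneg x) (by linarith)

lemma hasSum_abs_minusTerm {x : ℝ} (hx : |x| < 1) (k M : ℕ) :
    HasSum (fun ij : ℕ × ℕ => |minusTerm k x (M, ij)|)
      (1 / ((M : ℝ) + 1) ^ (2 * (k + 1)) * ((2 - |x / ((M : ℝ) + 1)|) /
        (1 - |x / ((M : ℝ) + 1)|) ^ (k + 1) * ∏ l ∈ range M, (1 + |x| / ((l : ℝ) + 1)))) := by
  have hy : |(|x / ((M : ℝ) + 1)|)| < 1 := by
    rw [abs_abs]
    exact (abs_div_natCast_add_one_le x M).trans_lt hx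
  have h₁ := hasSum_choose_add_choose hy k
  have h₂ := hasSum_harmonicChain |x| M
  have h := (h₁.mul h₂ (h₁.summable.mul_of_nonneg h₂.summable
    (fun i => by dsimp; positivity)
    fun j => mul_nonneg (by positivity) (harmonicChain_nonneg j M))).mul_left
      (1 / ((M : ℝ) + 1) ^ (2 * (k + 1)))
  refine (congrArg (HasSum · _) (funext fun ij => ?_)).mpr h
  simp only [minusTerm, abs_mul, abs_div (_ ^ _), abs_pow, abs_neg, abs_one, one_pow,
    abs_of_nonneg (harmonicChain_nonneg _ _), Nat.abs_cast,
    abs_of_pos (by positivity : 0 < (M : ℝ) + 1)]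

lemma summable_minusTerm {x : ℝ} (hx : |x| < 1) (k : ℕ) : Summable (minusTerm k x) := by
  refine Summable.of_abs ((summable_prod_of_nonneg fun _ => abs_nonneg _).2
    ⟨fun M => (hasSum_abs_minusTerm hx k M).summable, ?_⟩)
  simp only [(hasSum_abs_minusTerm hx k _).tsum_eq]
  have hx1 : 0 < 1 - |x| := by linarith
  refine Summable.of_nonneg_of_le (fun M => ?_) (fun M => ?_)
    ((summable_prod_one_add_div (abs_nonneg x) hx).mul_left (2 / (1 - |x|) ^ (k + 1)))
  · exact (hasSum_abs_minusTerm hx k M).nonneg fun _ => abs_nonneg _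
  · have hM : (0 : ℝ) ≤ M := Nat.cast_nonneg M
    have hy := abs_div_natCast_add_one_le x M
    have hy0 := abs_nonneg (x / ((M : ℝ) + 1))
    have hQ : 0 ≤ ∏ l ∈ range M, (1 + |x| / ((l : ℝ) + 1)) := prod_nonneg fun l _ => by positivity
    have hfrac : (2 - |x / ((M : ℝ) + 1)|) / (1 - |x / ((M : ℝ) + 1)|) ^ (k + 1) ≤
        2 / (1 - |x|) ^ (k + 1) :=
      div_le_div₀ (by norm_num) (by linarith) (by positivity)
        (pow_le_pow_left₀ hx1.le (by linarith) _)
    have hpow : 1 / ((M : ℝ) + 1) ^ (2 * (k + 1)) ≤ 1 / ((M : ℝ) + 1) ^ 2 :=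
      one_div_le_one_div_of_le (by positivity) (pow_le_pow_right₀ (by linarith) (by omega))
    calc _ ≤ 1 / ((M : ℝ) + 1) ^ 2 *
          (2 / (1 - |x|) ^ (k + 1) * ∏ l ∈ range M, (1 + |x| / ((l : ℝ) + 1))) :=
          mul_le_mul hpow (mul_le_mul_of_nonneg_right hfrac hQ)
            (mul_nonneg (div_nonneg (by linarith) (pow_nonneg (by linarith) _)) hQ) (by positivity)
      _ = _ := by ring

lemma hasSum_minusTerm {x : ℝ} (hx : |x| < 1) (k M : ℕ) :
    HasSum (fun ij : ℕ × ℕ => minusTerm k x (M, ij))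
      (minusWeight x M * starWeight x M ^ (k + 1)) := by
  have hy := (abs_div_natCast_add_one_le x M).trans_lt hx
  have h₁ := hasSum_choose_add_choose hy k
  have h₂ := hasSum_harmonicChain (-x) M
  have h := (h₁.mul h₂ (summable_mul_of_summable_norm h₁.summable.norm h₂.summable.norm)).mul_left
    ((-1) ^ M / ((M : ℝ) + 1) ^ (2 * (k + 1)))
  have h₃ := natCast_add_one_sub_pos (abs_lt.1 hx).2 M
  have h₄ : 1 - x / ((M : ℝ) + 1) = (M + 1 - x) / (M + 1) := by field_simp
  have hval : minusWeight x M * starWeight x M ^ (k + 1) =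
      (-1) ^ M / ((M : ℝ) + 1) ^ (2 * (k + 1)) * ((2 - x / ((M : ℝ) + 1)) /
        (1 - x / ((M : ℝ) + 1)) ^ (k + 1) * ∏ l ∈ range M, (1 + -x / ((l : ℝ) + 1))) := by
    rw [minusWeight, starWeight, h₄]
    simp only [neg_div, ← sub_eq_add_neg]
    rw [div_pow, div_pow, one_pow, mul_pow, pow_mul']
    field_simp
  rw [hval]
  exact h

lemma hasSum_zetaMinus {x : ℝ} (hx : |x| < 1) (k : ℕ) :
    (Summable fun M => minusWeight x M * starWeight x M ^ (k + 1)) ∧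
    HasSum (fun r => x ^ r * ∑ i ∈ range (r + 1), (-1 : ℝ) ^ (r - i) *
        (((k + 1 + i - 2).choose i + (k + 1 + i - 1).choose i : ℕ) : ℝ) *
        zetaMinus (fun j : Fin (r - i + 1) =>
          if j = Fin.last (r - i) then 2 * (k + 1) + i else 1))
      (∑' M, minusWeight x M * starWeight x M ^ (k + 1)) := by
  have hsum := summable_minusTerm hx k
  have hfib := hsum.hasSum.prod_fiberwise (hasSum_minusTerm hx k)
  refine ⟨hfib.summable, ?_⟩
  rw [hfib.tsum_eq]
  have hM : ∀ ij : ℕ × ℕ, HasSum (fun M => minusTerm k x (M, ij))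
      (x ^ (ij.1 + ij.2) * ((-1 : ℝ) ^ ij.2 *
        (((k + 1 + ij.1 - 2).choose ij.1 + (k + 1 + ij.1 - 1).choose ij.1 : ℕ) : ℝ) *
        zetaMinus (fun j : Fin (ij.2 + 1) =>
          if j = Fin.last ij.2 then 2 * (k + 1) + ij.1 else 1))) := by
    rintro ⟨i, j⟩
    have hs : Summable fun M => minusTerm k x (M, (i, j)) :=
      hsum.comp_injective (i := fun M => (M, (i, j))) fun _ _ h => (Prod.mk.inj h).1
    have h := hs.hasSum
    rw [zetaMinus_eq_tsum (summable_harmonicChain j (by omega)), ← mul_assoc, ← tsum_mul_left]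
    convert h using 1
    refine tsum_congr fun M => ?_
    rw [minusTerm, neg_pow x, div_pow, pow_add, pow_add]
    field_simp
  have hswap := ((Equiv.prodComm _ _).hasSum_iff.2 hsum.hasSum).prod_fiberwise hM
  have hsig := (HasAntidiagonal.sigmaAntidiagonalEquivProd (A := ℕ)).hasSum_iff.2 hswap
  refine hsig.sigma fun r => ?_
  rw [← Nat.succ_eq_add_one, ← Nat.sum_antidiagonal_eq_sum_range_succ (fun i j => (-1 : ℝ) ^ j *
    (((k + 1 + i - 2).choose i + (k + 1 + i - 1).choose i : ℕ) : ℝ) *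
    zetaMinus (fun l : Fin (j + 1) => if l = Fin.last j then 2 * (k + 1) + i else 1)), mul_sum,
    ← sum_coe_sort]
  convert hasSum_fintype _ using 2 with c
  simp only [Function.comp_apply, HasAntidiagonal.sigmaAntidiagonalEquivProd, Equiv.coe_fn_mk]
  rw [mem_antidiagonal.1 c.2]

lemma eq_of_hasSum_pow_mul {d e : ℕ → ℝ} {F : ℝ → ℝ}
    (hd : ∀ x, |x| < 1 → HasSum (fun r => x ^ r * d r) (F x))
    (he : ∀ x, |x| < 1 → HasSum (fun r => x ^ r * e r) (F x)) : d = e := by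
  have hnear : ∀ᶠ x : ℝ in 𝓝 0, |x| < 1 := by
    filter_upwards [Metric.ball_mem_nhds (0 : ℝ) one_pos] with x hx
    simpa using hx
  have key : ∀ c : ℕ → ℝ, (∀ x, |x| < 1 → HasSum (fun r => x ^ r * c r) (F x)) →
      HasFPowerSeriesAt F (FormalMultilinearSeries.ofScalars ℝ c) 0 := fun c hc => by
    rw [hasFPowerSeriesAt_iff]
    filter_upwards [hnear] with x hx
    simpa [FormalMultilinearSeries.coeff_ofScalars] using hc x hx
  funext r
  have h := (key d hd).eq_formalMultilinearSeries (key e he)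
  simpa only [FormalMultilinearSeries.coeff_ofScalars] using
    congrArg (fun p : FormalMultilinearSeries ℝ ℝ ℝ => p.coeff r) h

theorem stmt2 (r s : ℕ) (hs : 1 ≤ s) :
    (∑ i ∈ Finset.range (r + 1),
      (-1 : ℝ) ^ (r - i) * ((Nat.choose (s + i - 2) i + Nat.choose (s + i - 1) i : ℕ) : ℝ)
        * zetaMinus (fun j : Fin (r - i + 1) => if j = Fin.last (r - i) then 2 * s + i else 1))
    = ∑ c ∈ Finset.Nat.antidiagonalTuple s r, zetaStar (fun j : Fin s => c j + 2) := by
  obtain ⟨k, rfl⟩ := Nat.exists_eq_add_of_le' hs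
  refine congrFun (eq_of_hasSum_pow_mul (fun x hx => (hasSum_zetaMinus hx k).2)
    (e := fun r => ∑ c ∈ Nat.antidiagonalTuple (k + 1) r, zetaStar fun j => c j + 2)
    fun x hx => ?_) r
  rw [tendsto_nhds_unique
    (tendsto_chainSum_starWeight (abs_lt.1 hx).2 k (hasSum_zetaMinus hx k).1)
    (tendsto_chainSum_starWeight_tsum hx (k + 1))]
  exact (hasSum_zetaStar hx (k + 1)).2
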